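/- Let f be a transcendental self-map of ℂ*, written f(z) = z^n · exp(g(z) + h(1/z)) with n ∈ ℤ and g, h nonconstant entire functions, and suppose that f has a doubly connected Baker domain. Then ind(f) = 0, i.e. n = 0. -/

import Mathlib

open Complex Topology Filter Set Function OnePoint

noncomputable section

/-- The chordal (spherical) distance on the Riemann sphere, restricted to finite points. -/
def chordalDist (z w : ℂ) : ℝ :=
  ‖z - w‖ / Real.sqrt ((1 + ‖z‖ ^ 2) * (1 + ‖w‖ ^ 2))

/-- A transcendental self-map of `ℂ* = ℂ \ {0}`: a holomorphic self-map of the punctured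
plane with essential singularities at `0` and `∞`; equivalently, on `ℂ*` it has the form
`z ^ m * exp (g z + h z⁻¹)` for some `m : ℤ` and nonconstant entire functions `g, h`. -/
def IsTranscendentalSelfMapCStar (f : ℂ → ℂ) : Prop :=
  ∃ (m : ℤ) (g h : ℂ → ℂ),
    Differentiable ℂ g ∧ Differentiable ℂ h ∧
    (¬ ∃ c : ℂ, ∀ z, g z = c) ∧ (¬ ∃ c : ℂ, ∀ z, h z = c) ∧
    ∀ z : ℂ, z ≠ 0 → f z = z ^ m * Complex.exp (g z + h z⁻¹)

/-- The escaping set `I(f)` of a self-map of the punctured plane: points whose orbit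
accumulates only at `0` and `∞`. -/
def escapingSet (f : ℂ → ℂ) : Set ℂ :=
  {z | z ≠ 0 ∧ ∀ ε : ℝ, 0 < ε → ∃ N : ℕ, ∀ n ≥ N,
    ‖f^[n] z‖ < ε ∨ 1 / ε < ‖f^[n] z‖}

/-- The little escaping set `I_e(f)` with essential itinerary `e` (where `true` stands for the
symbol `∞` and `false` for the symbol `0`). -/
def littleEscapingSet (f : ℂ → ℂ) (e : ℕ → Bool) : Set ℂ :=
  {z | z ∈ escapingSet f ∧ ∃ ℓ k : ℕ, ∀ n : ℕ,
    (1 < ‖f^[n + ℓ] z‖ ↔ e (n + k) = true)}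

/-- The immediate little escaping set `Ĩ_e(f)`. -/
def immediateLittleEscapingSet (f : ℂ → ℂ) (e : ℕ → Bool) : Set ℂ :=
  {z | z ∈ escapingSet f ∧ ∃ ℓ : ℕ, ∀ n : ℕ,
    (1 < ‖f^[n + ℓ] z‖ ↔ e (n + ℓ) = true)}

/-- The Fatou set of a self-map of the punctured plane: points of `ℂ*` with a neighbourhood
(inside `ℂ*`) on which the family of iterates is equicontinuous w.r.t. the chordal metric. -/
def FatouSet (f : ℂ → ℂ) : Set ℂ :=
  {z | z ≠ 0 ∧ ∃ U : Set ℂ, IsOpen U ∧ z ∈ U ∧ (∀ w ∈ U, w ≠ 0) ∧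
    ∀ w ∈ U, ∀ ε : ℝ, 0 < ε → ∃ δ : ℝ, 0 < δ ∧ ∀ w' ∈ U,
      chordalDist w w' < δ → ∀ n : ℕ, chordalDist (f^[n] w) (f^[n] w') < ε}

/-- The Julia set `J(f) = ℂ* \ F(f)`. -/
def JuliaSet (f : ℂ → ℂ) : Set ℂ := {z : ℂ | z ≠ 0} \ FatouSet f

/-- A Fatou component: a connected component of the Fatou set. -/
def IsFatouComponent (f : ℂ → ℂ) (U : Set ℂ) : Prop :=
  ∃ z ∈ FatouSet f, U = connectedComponentIn (FatouSet f) z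

/-- A wandering domain: a Fatou component `U` such that the Fatou components containing the
iterated images `fⁿ(U)` are pairwise distinct. -/
def IsWanderingDomain (f : ℂ → ℂ) (U : Set ℂ) : Prop :=
  IsFatouComponent f U ∧ ∃ V : ℕ → Set ℂ, V 0 = U ∧
    (∀ n, IsFatouComponent f (V n)) ∧
    (∀ n, f '' V n ⊆ V (n + 1)) ∧ Function.Injective V

/-- A set is bounded in `ℂ*` if it lies in some closed annulus `{r ≤ |z| ≤ R}`. -/
def BoundedInCStar (X : Set ℂ) : Prop :=
  ∃ r R : ℝ, 0 < r ∧ r ≤ R ∧ X ⊆ {z : ℂ | r ≤ ‖z‖ ∧ ‖z‖ ≤ R}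

/-- The boundary of a subset of `ℂ*` taken in `ℂ*`. -/
def boundaryInCStar (G : Set ℂ) : Set ℂ := frontier G \ {0}

/-- The set `I(f) ∪ {0, ∞}` regarded as a subset of the Riemann sphere `ℂ̂ = ℂ ∪ {∞}`. -/
def escapingSphere (f : ℂ → ℂ) : Set (OnePoint ℂ) :=
  ((fun z : ℂ => (z : OnePoint ℂ)) '' escapingSet f) ∪ {((0 : ℂ) : OnePoint ℂ), ∞}

/-- The set `I_e(f) ∪ {0, ∞}` regarded as a subset of the Riemann sphere. -/
def littleEscapingSphere (f : ℂ → ℂ) (e : ℕ → Bool) : Set (OnePoint ℂ) :=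
  ((fun z : ℂ => (z : OnePoint ℂ)) '' littleEscapingSet f e) ∪ {((0 : ℂ) : OnePoint ℂ), ∞}

/-- A subset of the sphere has exactly two connected components. -/
def HasExactlyTwoComponents (K : Set (OnePoint ℂ)) : Prop :=
  ∃ x ∈ K, ∃ y ∈ K, connectedComponentIn K x ≠ connectedComponentIn K y ∧
    ∀ z ∈ K, connectedComponentIn K z = connectedComponentIn K x ∨
      connectedComponentIn K z = connectedComponentIn K y

/-- A domain `U ⊆ ℂ*` is doubly connected if its complement in the Riemann sphere has
exactly two connected components. -/
def DoublyConnected (U : Set ℂ) : Prop :=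
  HasExactlyTwoComponents (((fun z : ℂ => (z : OnePoint ℂ)) '' U)ᶜ)

/-- A transcendental entire function. -/
def IsTranscendentalEntire (f : ℂ → ℂ) : Prop :=
  Differentiable ℂ f ∧ ¬ ∃ p : Polynomial ℂ, ∀ z, f z = p.eval z

/-- The Fatou set of an entire function. -/
def FatouSetEntire (f : ℂ → ℂ) : Set ℂ :=
  {z | ∃ U : Set ℂ, IsOpen U ∧ z ∈ U ∧
    ∀ w ∈ U, ∀ ε : ℝ, 0 < ε → ∃ δ : ℝ, 0 < δ ∧ ∀ w' ∈ U,
      chordalDist w w' < δ → ∀ n : ℕ, chordalDist (f^[n] w) (f^[n] w') < ε}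

/-- The Julia set of an entire function. -/
def JuliaSetEntire (f : ℂ → ℂ) : Set ℂ := (FatouSetEntire f)ᶜ

/-- `f` has a finite asymptotic value. -/
def HasFiniteAsymptoticValue (f : ℂ → ℂ) : Prop :=
  ∃ (a : ℂ) (γ : ℝ → ℂ), ContinuousOn γ (Set.Ici (0 : ℝ)) ∧
    Tendsto (fun t => ‖γ t‖) atTop atTop ∧
    Tendsto (fun t => f (γ t)) atTop (nhds a)

/-- An entire function whose real part grows at most logarithmically is constant. -/
theorem exists_eq_const_of_re_le_log {g : ℂ → ℂ} (hg : Differentiable ℂ g) {A C : ℝ}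
    (hA : 0 ≤ A) (hb : ∀ z : ℂ, 1 ≤ ‖z‖ → (g z).re ≤ A * Real.log ‖z‖ + C) :
    ∃ c, ∀ z, g z = c := by
  obtain ⟨C₁, hC₁⟩ := (isCompact_closedBall (0 : ℂ) 1).exists_bound_of_continuousOn
    hg.continuous.continuousOn
  have hC₁0 : 0 ≤ C₁ := (norm_nonneg _).trans (hC₁ 0 (by simp))
  have key : ∀ z, ‖g z‖ ≤ ‖g 0‖ := by
    intro z
    have hlog : Tendsto (fun R : ℝ => Real.log R / R) atTop (𝓝 0) :=
      (Real.isLittleO_log_id_atTop).tendsto_div_nhds_zero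
    have hinv : Tendsto (fun R : ℝ => 1 / R) atTop (𝓝 0) := by
      simpa using tendsto_inv_atTop_zero (𝕜 := ℝ)
    have hlim : Tendsto (fun R : ℝ =>
        2 * (A * (Real.log R / R) + (|C| + C₁ + 1) * (1 / R)) * ‖z‖ / (1 - ‖z‖ * (1 / R)) +
          ‖g 0‖ * (1 + ‖z‖ * (1 / R)) / (1 - ‖z‖ * (1 / R))) atTop
        (𝓝 (2 * (A * 0 + (|C| + C₁ + 1) * 0) * ‖z‖ / (1 - ‖z‖ * 0) +
          ‖g 0‖ * (1 + ‖z‖ * 0) / (1 - ‖z‖ * 0))) := by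
      refine Tendsto.add (Tendsto.div ?_ ?_ (by simp)) (Tendsto.div ?_ ?_ (by simp))
      · exact (((hlog.const_mul A).add (hinv.const_mul _)).const_mul 2).mul_const _
      · exact (hinv.const_mul _).const_sub 1
      · exact ((hinv.const_mul _).const_add 1).const_mul _
      · exact (hinv.const_mul _).const_sub 1
    simp only [mul_zero, add_zero, zero_mul, sub_zero, mul_one, div_one, zero_add] at hlim
    refine ge_of_tendsto hlim ?_
    filter_upwards [eventually_gt_atTop (‖z‖ + 1)] with R hR
    have hz := norm_nonneg z
    have hR1 : 1 < R := by linarith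
    have hlogR : 0 ≤ Real.log R := Real.log_nonneg hR1.le
    have hM : 0 < A * Real.log R + (|C| + C₁ + 1) := by positivity
    have hmaps : Set.MapsTo g (Metric.ball 0 R)
        {w | w.re ≤ A * Real.log R + (|C| + C₁ + 1)} := by
      intro w hw
      rw [mem_ball_zero_iff] at hw
      change (g w).re ≤ _
      rcases le_or_gt 1 ‖w‖ with h1 | h1
      · have := hb w h1
        have h2 : Real.log ‖w‖ ≤ Real.log R := Real.log_le_log (by linarith) hw.le
        have := le_abs_self C
        nlinarith
      · have h2 := hC₁ w (by simpa using h1.le)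
        have h3 := Complex.re_le_norm (g w)
        have : 0 ≤ A * Real.log R := by positivity
        have := abs_nonneg C
        linarith
    have := Complex.borelCaratheodory hM hg.differentiableOn hmaps (by linarith)
      (z := z) (by simpa using (by linarith : ‖z‖ < R))
    refine this.trans_eq ?_
    have hR0 : R ≠ 0 := by linarith
    have hRz : R - ‖z‖ ≠ 0 := by linarith
    have h1 : 1 - ‖z‖ * (1 / R) ≠ 0 := by
      have : 1 - ‖z‖ * (1 / R) = (R - ‖z‖) / R := by field_simp
      rw [this]; positivity
    have h2 : 1 - ‖z‖ * (1 / R) = (R - ‖z‖) / R := by field_simp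
    rw [h2]
    field_simp
  refine hg.exists_const_forall_eq_of_bounded ?_
  exact isBounded_iff_forall_norm_le.2 ⟨‖g 0‖, by rintro _ ⟨z, rfl⟩; exact key z⟩

theorem exists_eq_const_of_norm_le {g h : ℂ → ℂ} (hg : Differentiable ℂ g)
    (hh : Differentiable ℂ h) {m : ℤ} {M : ℝ}
    (hb : ∀ z : ℂ, 1 ≤ ‖z‖ → ‖z ^ m * Complex.exp (g z + h z⁻¹)‖ ≤ M) :
    ∃ c, ∀ z, g z = c := by
  obtain ⟨H, hH⟩ := (isCompact_closedBall (0 : ℂ) 1).exists_bound_of_continuousOn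
    hh.continuous.continuousOn
  refine exists_eq_const_of_re_le_log hg (A := |(m : ℝ)|) (C := Real.log M + H)
    (abs_nonneg _) fun z hz => ?_
  have hz0 : 0 < ‖z‖ := by linarith
  have h1 := hb z hz
  rw [norm_mul, norm_zpow, Complex.norm_exp, Complex.add_re] at h1
  have h2 := Real.log_le_log (by positivity) h1
  rw [Real.log_mul (by positivity) (by positivity), Real.log_exp, Real.log_zpow] at h2
  have h3 := hH z⁻¹ (by simpa using inv_le_one_of_one_le₀ hz)
  have h4 := (abs_le.1 (Complex.abs_re_le_norm (h z⁻¹))).1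
  have h5 : -|(m : ℝ)| * Real.log ‖z‖ ≤ m * Real.log ‖z‖ :=
    mul_le_mul_of_nonneg_right (neg_abs_le _) (Real.log_nonneg hz)
  linarith

/-- `u` has a continuous logarithm on `K`. -/
def HasContinuousLogOn (u : ℂ → ℂ) (K : Set ℂ) : Prop :=
  ∃ ψ : ℂ → ℂ, ContinuousOn ψ K ∧ ∀ z ∈ K, Complex.exp (ψ z) = u z

theorem exists_continuous_log {G : ℂ → ℂ} (hG : Continuous G) (h0 : ∀ z, G z ≠ 0) :
    ∃ L : ℂ → ℂ, Continuous L ∧ ∀ z, Complex.exp (L z) = G z := by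
  have hsc : IsSimplyConnected (univ : Set ℂ) :=
    have := (convex_univ (𝕜 := ℝ) (E := ℂ)).contractibleSpace univ_nonempty
    SimplyConnectedSpace.ofContractible (univ : Set ℂ)
  obtain ⟨L, hL, hLG⟩ := Complex.exists_continuousOn_eqOn_exp_comp
    hsc isOpen_univ hG.continuousOn
    (by simpa using h0)
  exact ⟨L, continuousOn_univ.1 hL, fun z => hLG (mem_univ z)⟩

theorem not_hasContinuousLogOn_zpow_frontier {W : Set ℂ} (hWo : IsOpen W)
    (hWb : Bornology.IsBounded W) (h0 : (0 : ℂ) ∈ W) {k : ℤ} (hk : k ≠ 0) :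
    ¬ HasContinuousLogOn (fun z => z ^ k) (frontier W) := by
  classical
  rintro ⟨ψ, hψ, hexp⟩
  obtain ⟨Ψ, hΨ⟩ := ContinuousMap.exists_restrict_eq (isClosed_frontier (s := W))
    ⟨_, hψ.domRestrict⟩
  have hΨ' : ∀ z ∈ frontier W, Ψ z = ψ z := fun z hz =>
    congrArg (fun F : C(frontier W, ℂ) => F ⟨z, hz⟩) hΨ
  have hne : ∀ z ∈ closure Wᶜ, z ≠ 0 := by
    rintro z hz rfl
    rw [hWo.isClosed_compl.closure_eq] at hz
    exact hz h0
  have hGc : Continuous (W.piecewise (fun z => Complex.exp (Ψ z)) (fun z => z ^ k)) := by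
    refine continuous_piecewise ?_ ?_ ?_
    · intro a ha
      rw [hΨ' a ha, hexp a ha]
    · exact (Complex.continuous_exp.comp Ψ.continuous).continuousOn
    · exact fun z hz => (continuousAt_zpow₀ z k (Or.inl (hne z hz))).continuousWithinAt
  obtain ⟨L, hLc, hL⟩ := exists_continuous_log hGc (by
    intro z
    by_cases hz : z ∈ W
    · simp [hz]
    · simpa [hz] using zpow_ne_zero k (hne z (subset_closure hz)))
  obtain ⟨R, hR⟩ := hWb.subset_closedBall 0
  set R' : ℝ := |R| + 1 with hR'
  have hR'0 : 0 < R' := by positivity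
  have hcircle : ∀ θ : ℝ, Complex.exp (L (R' * Complex.exp (θ * I))) =
      (R' * Complex.exp (θ * I)) ^ k := by
    intro θ
    rw [hL, Set.piecewise_eq_of_notMem]
    intro hmem
    have := hR hmem
    rw [mem_closedBall_zero_iff, norm_mul, Complex.norm_exp_ofReal_mul_I, mul_one,
      Complex.norm_real, Real.norm_eq_abs, abs_of_pos hR'0] at this
    linarith [le_abs_self R]
  set q : ℝ → ℂ := fun θ => L (R' * Complex.exp (θ * I)) - k * (θ * I) with hq
  have hqc : Continuous q := by
    simp only [hq]
    fun_prop
  have hqe : ∀ θ, Complex.exp (q θ) = (R' : ℂ) ^ k := by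
    intro θ
    simp only [hq]
    rw [Complex.exp_sub, hcircle, mul_zpow, Complex.exp_int_mul,
      mul_div_assoc, div_self (zpow_ne_zero _ (Complex.exp_ne_zero _)), mul_one]
  have hqconst : q (2 * Real.pi) = q 0 := by
    have : ∀ θ, ∀ᶠ η in 𝓝 θ, q η = q θ := by
      intro θ
      have h1 : ∀ᶠ η in 𝓝 θ, ‖q η - q θ‖ < 1 := by
        have : Tendsto (fun η => ‖q η - q θ‖) (𝓝 θ) (𝓝 ‖q θ - q θ‖) :=
          ((hqc.tendsto θ).sub_const _).norm
        rw [sub_self, norm_zero] at this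
        exact this.eventually_lt_const one_pos
      filter_upwards [h1] with η hη
      obtain ⟨n, hn⟩ := Complex.exp_eq_exp_iff_exists_int.1 ((hqe η).trans (hqe θ).symm)
      rw [hn, add_sub_cancel_left, norm_mul] at hη
      have h2 : ‖(2 * (Real.pi : ℂ) * I)‖ = 2 * Real.pi := by
        simp [abs_of_pos Real.pi_pos]
      rw [h2, Complex.norm_intCast] at hη
      have hn0 : n = 0 := by
        by_contra hn0
        have : (1 : ℝ) ≤ |(n : ℝ)| := by exact_mod_cast Int.one_le_abs hn0
        nlinarith [Real.pi_gt_three]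
      rw [hn, hn0]; simp
    have hlc : IsLocallyConstant q := (IsLocallyConstant.iff_eventually_eq q).2 this
    exact hlc.apply_eq_of_isPreconnected isPreconnected_univ (mem_univ _) (mem_univ _)
  simp only [hq] at hqconst
  push_cast at hqconst
  rw [Complex.exp_two_pi_mul_I] at hqconst
  simp [hk, Real.pi_ne_zero] at hqconst

theorem isOpen_connectedComponentIn_compl {K : Set ℂ} (hK : IsClosed K) (a : ℂ) :
    IsOpen (connectedComponentIn Kᶜ a) :=
  hK.isOpen_compl.connectedComponentIn

theorem frontier_connectedComponentIn_compl_subset {K : Set ℂ} (hK : IsClosed K) (a : ℂ) :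
    frontier (connectedComponentIn Kᶜ a) ⊆ K := by
  intro x hx
  by_contra hxK
  have hxc : x ∈ connectedComponentIn Kᶜ x := mem_connectedComponentIn hxK
  have hnhds := (isOpen_connectedComponentIn_compl hK x).mem_nhds hxc
  obtain ⟨y, hy, hya⟩ := mem_closure_iff_nhds.1 hx.1 _ hnhds
  have := (connectedComponentIn_eq hy).trans (connectedComponentIn_eq hya).symm
  rw [this] at hxc
  exact hx.2 ((isOpen_connectedComponentIn_compl hK a).interior_eq.symm ▸ hxc)

theorem HasContinuousLogOn.mul {u v : ℂ → ℂ} {K : Set ℂ} (hu : HasContinuousLogOn u K)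
    (hv : HasContinuousLogOn v K) : HasContinuousLogOn (fun z => u z * v z) K := by
  obtain ⟨φ, hφ, hφu⟩ := hu
  obtain ⟨ψ, hψ, hψv⟩ := hv
  exact ⟨fun z => φ z + ψ z, hφ.add hψ, fun z hz => by
    rw [Complex.exp_add, hφu z hz, hψv z hz]⟩

theorem HasContinuousLogOn.inv {u : ℂ → ℂ} {K : Set ℂ} (hu : HasContinuousLogOn u K) :
    HasContinuousLogOn (fun z => (u z)⁻¹) K := by
  obtain ⟨φ, hφ, hφu⟩ := hu
  exact ⟨fun z => -φ z, hφ.neg, fun z hz => by rw [Complex.exp_neg, hφu z hz]⟩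

theorem HasContinuousLogOn.congr {u v : ℂ → ℂ} {K : Set ℂ} (hu : HasContinuousLogOn u K)
    (h : ∀ z ∈ K, v z = u z) : HasContinuousLogOn v K := by
  obtain ⟨φ, hφ, hφu⟩ := hu
  exact ⟨φ, hφ, fun z hz => by rw [hφu z hz, h z hz]⟩

theorem hasContinuousLogOn_of_norm_sub_one_lt {u : ℂ → ℂ} {K : Set ℂ} (hu : ContinuousOn u K)
    (h : ∀ z ∈ K, ‖u z - 1‖ < 1) : HasContinuousLogOn u K := by
  have hs : ∀ z ∈ K, u z ∈ Complex.slitPlane := fun z hz => by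
    have := Complex.mem_slitPlane_of_norm_lt_one (h z hz)
    simpa using this
  exact ⟨fun z => Complex.log (u z), hu.clog hs,
    fun z hz => Complex.exp_log (Complex.slitPlane_ne_zero (hs z hz))⟩

/-- If the identity has no continuous logarithm on the compact set `K`, then `K` separates
`0` from `∞`. -/
theorem isBounded_connectedComponentIn_compl {K : Set ℂ} (hK : IsCompact K)
    (hlog : ¬ HasContinuousLogOn id K) :
    Bornology.IsBounded (connectedComponentIn Kᶜ 0) := by
  by_cases h0 : (0 : ℂ) ∈ Kᶜ
  swap
  · rw [connectedComponentIn_eq_empty h0]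
    exact Bornology.isBounded_empty
  set D := connectedComponentIn Kᶜ 0 with hD
  have hDK : ∀ c ∈ D, ∀ z ∈ K, z - c ≠ 0 := fun c hc z hz h =>
    connectedComponentIn_subset _ _ hc (sub_eq_zero.1 h ▸ hz)
  have hquot : ∀ c ∈ D, ∀ d ∈ D, HasContinuousLogOn (fun z => (z - d) / (z - c)) K := by
    intro c hc d hd
    refine isPreconnected_connectedComponentIn.induction₂
      (fun c d => HasContinuousLogOn (fun z => (z - d) / (z - c)) K) ?_ ?_ ?_ hc hd
    · intro c hc
      obtain ⟨r, hr, hrD⟩ := Metric.isOpen_iff.1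
        (isOpen_connectedComponentIn_compl hK.isClosed 0) c hc
      filter_upwards [mem_nhdsWithin_of_mem_nhds (Metric.ball_mem_nhds c hr)] with d hd
      refine hasContinuousLogOn_of_norm_sub_one_lt ?_ ?_
      · exact ContinuousOn.div (by fun_prop) (by fun_prop) (hDK c hc)
      · intro z hz
        have hne := hDK c hc z hz
        have : (z - d) / (z - c) - 1 = (c - d) / (z - c) := by field_simp; ring
        rw [this, norm_div, div_lt_one (norm_pos_iff.2 hne)]
        have h1 : r ≤ ‖z - c‖ := by
          by_contra hlt
          exact connectedComponentIn_subset _ _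
            (hrD (by rw [Metric.mem_ball, dist_eq_norm]; exact not_le.1 hlt)) hz
        rw [Metric.mem_ball, dist_comm, dist_eq_norm] at hd
        linarith
    · intro x y w hx hy hw hxy hyw
      refine (hxy.mul hyw).congr fun z hz => ?_
      have := hDK x hx z hz
      have := hDK y hy z hz
      field_simp
    · intro x y hx hy hxy
      exact hxy.inv.congr fun z hz => (inv_div _ _).symm
  by_contra hunb
  obtain ⟨R, hR⟩ := hK.isBounded.exists_norm_le
  obtain ⟨c, hc, hcR⟩ : ∃ c ∈ D, max R 0 < ‖c‖ := by
    by_contra! hcon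
    exact hunb (isBounded_iff_forall_norm_le.2 ⟨_, hcon⟩)
  have hc0 : 0 < ‖c‖ := (le_max_right _ _).trans_lt hcR
  have hc0' : c ≠ 0 := norm_pos_iff.1 hc0
  have h1 : HasContinuousLogOn (fun z => 1 - z / c) K := by
    refine hasContinuousLogOn_of_norm_sub_one_lt (by fun_prop) fun z hz => ?_
    rw [sub_sub_cancel_left, norm_neg, norm_div, div_lt_one hc0]
    exact ((hR z hz).trans (le_max_left _ _)).trans_lt hcR
  have h2 : HasContinuousLogOn (fun _ => -c) K :=
    ⟨fun _ => Complex.log (-c), continuousOn_const, fun z _ =>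
      Complex.exp_log (neg_ne_zero.2 hc0')⟩
  refine hlog (((hquot 0 (mem_connectedComponentIn h0) c hc).inv.mul (h1.mul h2)).congr
    fun z hz => ?_)
  have hz1 := hDK c hc z hz
  have : (1 - z / c) * -c = z - c := by field_simp; ring
  rw [this, sub_zero, inv_div, div_mul_cancel₀ _ hz1, id]

/-- A holomorphic function on `ℂ*` that is bounded by `1` on arbitrarily distant compact sets
around `0` is bounded near `∞`. -/
theorem exists_norm_le_of_separating {F : ℂ → ℂ} (hF : DifferentiableOn ℂ F {0}ᶜ)
    (hK : ∀ R : ℝ, ∃ K : Set ℂ, IsCompact K ∧ (∀ z ∈ K, R < ‖z‖) ∧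
      ¬ HasContinuousLogOn id K ∧ ∀ z ∈ K, ‖F z‖ ≤ 1) :
    ∃ M : ℝ, ∀ z : ℂ, 1 ≤ ‖z‖ → ‖F z‖ ≤ M := by
  obtain ⟨M, hM⟩ := (isCompact_sphere (0 : ℂ) 1).exists_bound_of_continuousOn
    (hF.continuousOn.mono fun z hz => by
      rintro rfl
      simp at hz)
  refine ⟨max 1 M, fun c hc => ?_⟩
  rcases hc.eq_or_lt with hc1 | hc1
  · exact (hM c (by simpa using hc1.symm)).trans (le_max_right _ _)
  obtain ⟨K, hKc, hKR, hKlog, hKF⟩ := hK ‖c‖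
  have hball : Metric.closedBall (0 : ℂ) ‖c‖ ⊆ connectedComponentIn Kᶜ 0 := by
    refine (convex_closedBall _ _).isPreconnected.subset_connectedComponentIn (by simp) ?_
    intro z hz hzK
    exact absurd (hKR z hzK) (not_lt.2 (by simpa using hz))
  set Ω := connectedComponentIn Kᶜ 0 ∩ (Metric.closedBall (0 : ℂ) 1)ᶜ with hΩ
  have hcl : closure Ω ⊆ {z : ℂ | 1 ≤ ‖z‖} := by
    refine closure_minimal ?_ (isClosed_le continuous_const continuous_norm)
    rintro z ⟨-, hz⟩
    exact (not_le.1 (by simpa using hz)).le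
  have hbd : Bornology.IsBounded Ω :=
    (isBounded_connectedComponentIn_compl hKc hKlog).subset inter_subset_left
  refine Complex.norm_le_of_forall_mem_frontier_norm_le hbd
    (DifferentiableOn.diffContOnCl (hF.mono fun z hz => ?_)) (fun z hz => ?_)
    (subset_closure ⟨hball (by simp), by simpa using hc1⟩)
  · rintro rfl
    have := hcl hz
    simp only [mem_ofPred_eq, norm_zero] at this
    linarith
  · rcases frontier_inter_subset _ _ hz with ⟨hz, -⟩ | ⟨-, hz⟩
    · exact (hKF z (frontier_connectedComponentIn_compl_subset hKc.isClosed 0 hz)).trans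
        (le_max_left _ _)
    · rw [frontier_compl, frontier_closedBall _ one_ne_zero] at hz
      exact (hM z hz).trans (le_max_right _ _)

theorem differentiableOn_zpow_mul_exp {g h : ℂ → ℂ} (hg : Differentiable ℂ g)
    (hh : Differentiable ℂ h) (m : ℤ) :
    DifferentiableOn ℂ (fun z => z ^ m * Complex.exp (g z + h z⁻¹)) {0}ᶜ := by
  intro z hz
  have hz' : z ≠ 0 := hz
  have h1 : DifferentiableAt ℂ (fun z => h z⁻¹) z :=
    (hh z⁻¹).comp z (differentiableAt_inv hz')
  exact ((differentiableAt_zpow.2 (Or.inl hz')).mul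
    ((hg z).add h1).cexp).differentiableWithinAt

theorem exists_eq_const_of_norm_le_one_on_separating {g h : ℂ → ℂ} (hg : Differentiable ℂ g)
    (hh : Differentiable ℂ h) {m : ℤ}
    (hK : ∀ R : ℝ, ∃ K : Set ℂ, IsCompact K ∧ (∀ z ∈ K, R < ‖z‖) ∧
      ¬ HasContinuousLogOn id K ∧ ∀ z ∈ K, ‖z ^ m * Complex.exp (g z + h z⁻¹)‖ ≤ 1) :
    ∃ c, ∀ z, g z = c := by
  obtain ⟨M, hM⟩ := exists_norm_le_of_separating (differentiableOn_zpow_mul_exp hg hh m) hK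
  exact exists_eq_const_of_norm_le hg hh hM

theorem exists_eq_const_of_one_le_norm_on_separating {g h : ℂ → ℂ} (hg : Differentiable ℂ g)
    (hh : Differentiable ℂ h) {m : ℤ}
    (hK : ∀ R : ℝ, ∃ K : Set ℂ, IsCompact K ∧ (∀ z ∈ K, R < ‖z‖) ∧
      ¬ HasContinuousLogOn id K ∧ ∀ z ∈ K, 1 ≤ ‖z ^ m * Complex.exp (g z + h z⁻¹)‖) :
    ∃ c, ∀ z, g z = c := by
  obtain ⟨c, hc⟩ := exists_eq_const_of_norm_le_one_on_separating hg.neg hh.neg (m := -m)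
    fun R => by
      obtain ⟨K, hKc, hKR, hKlog, hKF⟩ := hK R
      refine ⟨K, hKc, hKR, hKlog, fun z hz => ?_⟩
      have : z ^ (-m) * Complex.exp ((-g) z + (-h) z⁻¹) =
          (z ^ m * Complex.exp (g z + h z⁻¹))⁻¹ := by
        rw [zpow_neg, mul_inv, ← Complex.exp_neg, neg_add, Pi.neg_apply, Pi.neg_apply]
      rw [this, norm_inv]
      exact inv_le_one_of_one_le₀ (hKF z hz)
  exact ⟨-c, fun z => by rw [← hc z, Pi.neg_apply, neg_neg]⟩

/-- Iterates of `z ^ m * exp (g z + h z⁻¹)` have index `m ^ n`. -/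
theorem exists_iterate_eq_zpow_mul_exp {f g h : ℂ → ℂ} {m : ℤ} (hg : Differentiable ℂ g)
    (hh : Differentiable ℂ h)
    (hform : ∀ z : ℂ, z ≠ 0 → f z = z ^ m * Complex.exp (g z + h z⁻¹)) (n : ℕ) :
    ∃ H : ℂ → ℂ, DifferentiableOn ℂ H {0}ᶜ ∧
      ∀ z ≠ 0, f^[n] z = z ^ (m ^ n) * Complex.exp (H z) := by
  induction n with
  | zero => exact ⟨fun _ => 0, differentiableOn_const _, fun z _ => by simp⟩
  | succ n ih =>
    obtain ⟨H, hH, hHf⟩ := ih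
    have hne : ∀ z ≠ 0, f^[n] z ≠ 0 := fun z hz => by
      rw [hHf z hz]
      exact mul_ne_zero (zpow_ne_zero _ hz) (Complex.exp_ne_zero _)
    have hd : DifferentiableOn ℂ f^[n] {0}ᶜ :=
      DifferentiableOn.congr (fun z hz => ((differentiableAt_zpow.2
        (Or.inl hz)).differentiableWithinAt.mul (hH z hz).cexp)) hHf
    refine ⟨fun z => m * H z + (g (f^[n] z) + h (f^[n] z)⁻¹), ?_, fun z hz => ?_⟩
    · exact (hH.const_mul _).add ((hg.comp_differentiableOn hd).add
        (hh.comp_differentiableOn (hd.inv hne)))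
    · rw [Function.iterate_succ_apply', hform _ (hne z hz)]
      dsimp only
      rw [Complex.exp_add (m * H z), Complex.exp_int_mul, ← mul_assoc, pow_succ, zpow_mul,
        ← mul_zpow, ← hHf z hz]

theorem HasContinuousLogOn.comp {u : ℂ → ℂ} {C : Set ℂ} (hu : ContinuousOn u C)
    (hlog : HasContinuousLogOn id (u '' C)) : HasContinuousLogOn u C := by
  obtain ⟨ψ, hψ, h⟩ := hlog
  exact ⟨fun z => ψ (u z), hψ.comp hu (mapsTo_image u C), fun z hz => h _ ⟨z, hz, rfl⟩⟩

theorem chordalDist_inv {a b : ℂ} (ha : a ≠ 0) (hb : b ≠ 0) :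
    chordalDist a⁻¹ b⁻¹ = chordalDist a b := by
  have ha' : 0 < ‖a‖ := norm_pos_iff.2 ha
  have hb' : 0 < ‖b‖ := norm_pos_iff.2 hb
  have h1 : a⁻¹ - b⁻¹ = (b - a) / (a * b) := by field_simp
  have h2 : (1 + ‖a⁻¹‖ ^ 2) * (1 + ‖b⁻¹‖ ^ 2) =
      ((1 + ‖a‖ ^ 2) * (1 + ‖b‖ ^ 2)) / (‖a‖ * ‖b‖) ^ 2 := by
    rw [norm_inv, norm_inv]
    field_simp
    ring
  unfold chordalDist
  rw [h1, h2, Real.sqrt_div (by positivity), Real.sqrt_sq (by positivity), norm_div, norm_mul,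
    norm_sub_rev, div_div_div_cancel_right₀ (by positivity)]

theorem norm_lt_of_chordalDist_lt {a b : ℂ} {η : ℝ} (hη : 0 < η) (hη1 : η ≤ 1)
    (ha : ‖a‖ < η / 2) (hab : chordalDist a b < η / 4) : ‖b‖ < η := by
  by_contra! hb
  unfold chordalDist at hab
  have hs : 0 < Real.sqrt ((1 + ‖a‖ ^ 2) * (1 + ‖b‖ ^ 2)) := by positivity
  rw [div_lt_iff₀ hs] at hab
  have h1 : ‖b‖ / 2 ≤ ‖a - b‖ := by
    have := norm_sub_norm_le b a
    rw [norm_sub_rev] at this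
    linarith
  have h2 : ‖b‖ / 2 < η / 4 * Real.sqrt ((1 + ‖a‖ ^ 2) * (1 + ‖b‖ ^ 2)) := h1.trans_lt hab
  have h3 := pow_lt_pow_left₀ h2 (by positivity) two_ne_zero
  rw [mul_pow, Real.sq_sqrt (by positivity)] at h3
  have ha2 : ‖a‖ ^ 2 ≤ 1 / 4 := by nlinarith [norm_nonneg a]
  have hη2 : η ^ 2 ≤ 1 := by nlinarith
  have hb2 : η ^ 2 ≤ ‖b‖ ^ 2 := pow_le_pow_left₀ hη.le hb 2
  have h4 : (1 + ‖a‖ ^ 2) * (1 + ‖b‖ ^ 2) ≤ 5 / 4 * (1 + ‖b‖ ^ 2) :=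
    mul_le_mul_of_nonneg_right (by linarith) (by positivity)
  have h5 : η ^ 2 * ((1 + ‖a‖ ^ 2) * (1 + ‖b‖ ^ 2)) ≤ η ^ 2 * (5 / 4 * (1 + ‖b‖ ^ 2)) :=
    mul_le_mul_of_nonneg_left h4 (by positivity)
  have h6 : η ^ 2 * ‖b‖ ^ 2 ≤ ‖b‖ ^ 2 := mul_le_of_le_one_left (by positivity) hη2
  nlinarith [sq_nonneg ‖b‖, sq_nonneg η]

theorem chordalDist_le_norm_sub (a b : ℂ) : chordalDist a b ≤ ‖a - b‖ := by
  refine div_le_self (norm_nonneg _) (Real.one_le_sqrt.2 ?_)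
  nlinarith [sq_nonneg ‖a‖, sq_nonneg ‖b‖, mul_nonneg (sq_nonneg ‖a‖) (sq_nonneg ‖b‖)]

theorem norm_sub_le_chordalDist_mul {a b : ℂ} {B : ℝ} (ha : ‖a‖ ≤ B) (hb : ‖b‖ ≤ B) :
    ‖a - b‖ ≤ chordalDist a b * (1 + B ^ 2) := by
  have hs : 0 < Real.sqrt ((1 + ‖a‖ ^ 2) * (1 + ‖b‖ ^ 2)) := by positivity
  have h1 : Real.sqrt ((1 + ‖a‖ ^ 2) * (1 + ‖b‖ ^ 2)) ≤ 1 + B ^ 2 := by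
    rw [Real.sqrt_le_left (by positivity), pow_two (1 + B ^ 2)]
    gcongr
  calc ‖a - b‖ = chordalDist a b * Real.sqrt ((1 + ‖a‖ ^ 2) * (1 + ‖b‖ ^ 2)) := by
        unfold chordalDist
        field_simp
    _ ≤ _ := by
        refine mul_le_mul_of_nonneg_left h1 ?_
        unfold chordalDist
        positivity

theorem isOpen_fatouSet (f : ℂ → ℂ) : IsOpen (FatouSet f) := by
  rw [isOpen_iff_mem_nhds]
  rintro z ⟨-, V, hV, hzV, hV0, hVeq⟩
  exact mem_of_superset (hV.mem_nhds hzV) fun w hw => ⟨hV0 w hw, V, hV, hw, hV0, hVeq⟩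

theorem IsFatouComponent.isOpen {f : ℂ → ℂ} {U : Set ℂ} (hU : IsFatouComponent f U) :
    IsOpen U := by
  obtain ⟨z, -, rfl⟩ := hU
  exact (isOpen_fatouSet f).connectedComponentIn

theorem eventually_chordalDist_iterate_lt {f : ℂ → ℂ} {z : ℂ} (hz : z ∈ FatouSet f) {ε : ℝ}
    (hε : 0 < ε) : ∀ᶠ w in 𝓝 z, ∀ n : ℕ, chordalDist (f^[n] z) (f^[n] w) < ε := by
  obtain ⟨-, V, hV, hzV, hV0, hVeq⟩ := hz
  obtain ⟨δ, hδ, h⟩ := hVeq z hzV ε hε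
  filter_upwards [hV.mem_nhds hzV, Metric.ball_mem_nhds z hδ] with w hw hwδ
  refine h w hw ((chordalDist_le_norm_sub z w).trans_lt ?_)
  rwa [Metric.mem_ball, dist_comm, dist_eq_norm] at hwδ

/-- Near a point of `F(f) ∩ I(f)`, orbits tend to the same essential singularity as
that of the point, locally uniformly. -/
theorem eventually_iterate_same_side {f : ℂ → ℂ} (hf : ∀ z ≠ 0, ∀ n : ℕ, f^[n] z ≠ 0) {z : ℂ}
    (hz : z ∈ FatouSet f) (hzI : z ∈ escapingSet f) {η : ℝ} (hη : 0 < η) (hη1 : η ≤ 1) :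
    ∀ᶠ q : ℕ × ℂ in atTop ×ˢ 𝓝 z,
      (‖f^[q.1] z‖ ≤ 1 → ‖f^[q.1] q.2‖ < η) ∧ (1 < ‖f^[q.1] z‖ → 1 / η < ‖f^[q.1] q.2‖) := by
  obtain ⟨N, hN⟩ := hzI.2 (η / 2) (by positivity)
  have h1 : (1 : ℝ) < 1 / (η / 2) := by
    rw [lt_div_iff₀ (by positivity)]
    linarith
  filter_upwards [(eventually_ge_atTop N).prod_mk
    ((eventually_chordalDist_iterate_lt hz (ε := η / 4) (by positivity)).and
      (isOpen_compl_singleton.mem_nhds hz.1))] with ⟨n, w⟩ ⟨hn, hw, hw0⟩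
  rcases hN n hn with h | h
  · exact ⟨fun _ => norm_lt_of_chordalDist_lt hη hη1 h (hw n), fun h' => by linarith⟩
  · refine ⟨fun h' => by linarith, fun _ => ?_⟩
    have hz0 := hf z hz.1 n
    have hw0' := hf w hw0 n
    have h2 : ‖(f^[n] z)⁻¹‖ < η / 2 := by
      rw [norm_inv]
      exact inv_lt_of_inv_lt₀ (by positivity) (by simpa using h)
    have h3 := norm_lt_of_chordalDist_lt hη hη1 h2
      (b := (f^[n] w)⁻¹) (by rw [chordalDist_inv hz0 hw0']; exact hw n)
    rw [norm_inv] at h3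
    rw [one_div]
    exact inv_lt_of_inv_lt₀ (norm_pos_iff.2 hw0') h3

/-- On compact subsets of a connected set in `F(f) ∩ I(f)` the iterates are eventually
uniformly close to `0` or uniformly close to `∞`. -/
theorem eventually_iterate_uniform {f : ℂ → ℂ} (hf : ∀ z ≠ 0, ∀ n : ℕ, f^[n] z ≠ 0) {U : Set ℂ}
    (hU : IsPreconnected U) (hUF : U ⊆ FatouSet f) (hUI : U ⊆ escapingSet f) {z : ℂ}
    (hz : z ∈ U) {C : Set ℂ} (hC : IsCompact C) (hCU : C ⊆ U) {η : ℝ} (hη : 0 < η)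
    (hη1 : η ≤ 1) :
    ∀ᶠ n : ℕ in atTop, ∀ w ∈ C,
      (‖f^[n] z‖ ≤ 1 → ‖f^[n] w‖ < η) ∧ (1 < ‖f^[n] z‖ → 1 / η < ‖f^[n] w‖) := by
  have hrel : ∀ a ∈ U, ∀ b ∈ U, ∀ᶠ n : ℕ in atTop, (1 < ‖f^[n] a‖ ↔ 1 < ‖f^[n] b‖) := by
    intro a ha b hb
    refine hU.induction₂ (fun a b => ∀ᶠ n : ℕ in atTop, (1 < ‖f^[n] a‖ ↔ 1 < ‖f^[n] b‖))
      ?_ ?_ ?_ ha hb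
    · intro a ha
      have := (eventually_iterate_same_side hf (hUF ha) (hUI ha) one_pos le_rfl)
      obtain ⟨p, hp, q, hq, hpq⟩ := eventually_prod_iff.1 this
      filter_upwards [mem_nhdsWithin_of_mem_nhds hq] with b hb
      filter_upwards [hp] with n hpn
      have hn := hpq hpn hb
      simp only [one_div_one] at hn
      exact ⟨hn.2, fun h => by
        by_contra hcon
        exact absurd (hn.1 (not_lt.1 hcon)) (not_lt.2 h.le)⟩
    · intro a b c _ _ _ hab hbc
      filter_upwards [hab, hbc] with n h1 h2 using h1.trans h2
    · intro a b _ _ hab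
      filter_upwards [hab] with n h1 using h1.symm
  have hloc : ∀ a ∈ C, ∀ᶠ q : ℕ × ℂ in atTop ×ˢ 𝓝 a,
      (‖f^[q.1] z‖ ≤ 1 → ‖f^[q.1] q.2‖ < η) ∧
        (1 < ‖f^[q.1] z‖ → 1 / η < ‖f^[q.1] q.2‖) := by
    intro a ha
    filter_upwards [eventually_iterate_same_side hf (hUF (hCU ha)) (hUI (hCU ha)) hη hη1,
      (hrel z hz a (hCU ha)).prod_inl (𝓝 a)] with q hq hq'
    rwa [← not_lt, hq', not_lt]
  have : ∀ᶠ q : ℕ × ℂ in atTop ×ˢ 𝓝ˢ C, (‖f^[q.1] z‖ ≤ 1 → ‖f^[q.1] q.2‖ < η) ∧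
        (1 < ‖f^[q.1] z‖ → 1 / η < ‖f^[q.1] q.2‖) := hC.mem_prod_nhdsSet_of_forall hloc
  exact this.curry.mono fun n hn => hn.self_of_nhdsSet

theorem exists_compact_compl_component {U : Set ℂ} (hU : IsOpen U) (hdc : DoublyConnected U) :
    ∃ A : Set ℂ, IsCompact A ∧ A.Nonempty ∧ Disjoint A U ∧ IsOpen (A ∪ U) := by
  set S : Set (OnePoint ℂ) := (((fun z : ℂ => (z : OnePoint ℂ)) '' U)ᶜ) with hS
  have hSc : IsClosed S := (OnePoint.isOpen_image_coe.2 hU).isClosed_compl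
  have hinf : ∞ ∈ S := by simp [hS]
  have hcomp : ∀ x ∈ S, IsClosed (connectedComponentIn S x) := fun x hx =>
    isClosed_of_closure_subset <|
      isPreconnected_connectedComponentIn.closure.subset_connectedComponentIn
        (subset_closure (mem_connectedComponentIn hx))
        (closure_minimal (connectedComponentIn_subset S x) hSc)
  obtain ⟨x, hx, hxinf, hcov⟩ : ∃ x ∈ S, connectedComponentIn S x ≠ connectedComponentIn S ∞ ∧
      ∀ z ∈ S, connectedComponentIn S z = connectedComponentIn S x ∨
        connectedComponentIn S z = connectedComponentIn S ∞ := by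
    obtain ⟨x, hx, y, hy, hxy, hcov⟩ := hdc
    rcases hcov ∞ hinf with h | h
    · exact ⟨y, hy, h ▸ hxy.symm, fun z hz => h ▸ (hcov z hz).symm⟩
    · exact ⟨x, hx, h ▸ hxy, fun z hz => h ▸ hcov z hz⟩
  have hnot : ∞ ∉ connectedComponentIn S x := fun h => hxinf (connectedComponentIn_eq h)
  set A : Set ℂ := (fun z : ℂ => (z : OnePoint ℂ)) ⁻¹' connectedComponentIn S x with hA
  have himg : (fun z : ℂ => (z : OnePoint ℂ)) '' A = connectedComponentIn S x := by
    rw [hA, image_preimage_eq_iff]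
    intro y hy
    induction y using OnePoint.rec with
    | infty => exact absurd hy hnot
    | coe a => exact ⟨a, rfl⟩
  refine ⟨A, ?_, ?_, ?_, ?_⟩
  · exact (OnePoint.isClosed_image_coe.1 (himg ▸ hcomp x hx)).2
  · have hne : ((fun z : ℂ => (z : OnePoint ℂ)) '' A).Nonempty := by
      rw [himg]
      exact ⟨x, mem_connectedComponentIn hx⟩
    exact image_nonempty.1 hne
  · rw [Set.disjoint_left]
    intro a ha haU
    exact connectedComponentIn_subset S x ha ⟨a, haU, rfl⟩
  · have : A ∪ U = (fun z : ℂ => (z : OnePoint ℂ)) ⁻¹' (connectedComponentIn S ∞)ᶜ := by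
      ext a
      constructor
      · rintro (ha | ha) hinfa
        · exact hxinf ((connectedComponentIn_eq ha).trans (connectedComponentIn_eq hinfa).symm)
        · exact connectedComponentIn_subset S ∞ hinfa ⟨a, ha, rfl⟩
      · intro ha
        by_cases haU : a ∈ U
        · exact Or.inr haU
        · have haS : (a : OnePoint ℂ) ∈ S := by
            rintro ⟨b, hb, hba⟩
            exact haU (OnePoint.coe_injective hba ▸ hb)
          rcases hcov _ haS with h | h
          · exact Or.inl (show (a : OnePoint ℂ) ∈ _ from h ▸ mem_connectedComponentIn haS)
          · exact absurd (h ▸ mem_connectedComponentIn haS) ha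
    rw [this]
    exact (hcomp ∞ hinf).isOpen_compl.preimage OnePoint.continuous_coe

theorem chordalDist_lt_of_norm_lt {a b : ℂ} {η : ℝ} (ha : ‖a‖ < η) (hb : ‖b‖ < η) :
    chordalDist a b < 2 * η :=
  (chordalDist_le_norm_sub a b).trans_lt <| (norm_sub_le a b).trans_lt (by linarith)

/-- A relatively compact open subset of `ℂ*` whose boundary lies in a connected set of escaping
Fatou points is contained in the Fatou set. -/
theorem subset_fatouSet_of_frontier_subset {f : ℂ → ℂ} (hf : ∀ z ≠ 0, ∀ n : ℕ, f^[n] z ≠ 0)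
    (hfd : ∀ n : ℕ, DifferentiableOn ℂ f^[n] {0}ᶜ) {U W : Set ℂ} (hU : IsPreconnected U)
    (hUF : U ⊆ FatouSet f) (hUI : U ⊆ escapingSet f) (hWo : IsOpen W)
    (hWc : IsCompact (closure W)) (hW0 : closure W ⊆ {0}ᶜ) (hWU : frontier W ⊆ U)
    (hUne : U.Nonempty) : W ⊆ FatouSet f := by
  obtain ⟨z, hz⟩ := hUne
  obtain ⟨B, hB⟩ := hWc.isBounded.exists_norm_le
  have hunif : ∀ η : ℝ, 0 < η → η ≤ 1 → ∀ᶠ n : ℕ in atTop, ∀ a ∈ W, ∀ b ∈ W,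
      chordalDist (f^[n] a) (f^[n] b) < 3 * η := by
    intro η hη hη1
    filter_upwards [eventually_iterate_uniform hf hU hUF hUI hz
      (hWc.of_isClosed_subset isClosed_frontier frontier_subset_closure) hWU hη hη1] with n hn
    have hbd : Bornology.IsBounded W := hWc.isBounded.subset subset_closure
    rcases le_or_gt ‖f^[n] z‖ 1 with h1 | h1
    · have hle : ∀ a ∈ W, ‖f^[n] a‖ ≤ η := fun a ha =>
        Complex.norm_le_of_forall_mem_frontier_norm_le hbd
          ((hfd n).mono hW0).diffContOnCl (fun w hw => ((hn w hw).1 h1).le) (subset_closure ha)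
      intro a ha b hb
      have := chordalDist_lt_of_norm_lt (η := 3 / 2 * η) ((hle a ha).trans_lt (by linarith))
        ((hle b hb).trans_lt (by linarith))
      linarith
    · have hle : ∀ a ∈ W, ‖(f^[n] a)⁻¹‖ ≤ η := fun a ha =>
        Complex.norm_le_of_forall_mem_frontier_norm_le (f := fun a => (f^[n] a)⁻¹) hbd
          (((hfd n).inv fun w hw => hf w hw n).mono hW0).diffContOnCl (fun w hw => by
            have := (hn w hw).2 h1
            rw [norm_inv]
            rw [one_div] at this
            exact (inv_lt_of_inv_lt₀ hη this).le) (subset_closure ha)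
      intro a ha b hb
      have := chordalDist_lt_of_norm_lt (η := 3 / 2 * η) ((hle a ha).trans_lt (by linarith))
        ((hle b hb).trans_lt (by linarith))
      rw [chordalDist_inv (hf a (hW0 (subset_closure ha)) n)
        (hf b (hW0 (subset_closure hb)) n)] at this
      linarith
  intro w hw
  refine ⟨hW0 (subset_closure hw), W, hWo, hw, fun a ha => hW0 (subset_closure ha), ?_⟩
  intro a ha ε hε
  obtain ⟨N, hN⟩ := eventually_atTop.1
    (hunif (min (ε / 3) 1) (by positivity) (min_le_right _ _))
  have hcont : ∀ᶠ b in 𝓝 a, ∀ n ∈ Finset.range N, ‖f^[n] a - f^[n] b‖ < ε := by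
    rw [Filter.eventually_all_finset]
    intro n _
    have hca : ContinuousAt f^[n] a := (hfd n).continuousOn.continuousAt
      (isOpen_compl_singleton.mem_nhds (hW0 (subset_closure ha)))
    have : Tendsto (fun b => ‖f^[n] a - f^[n] b‖) (𝓝 a) (𝓝 ‖f^[n] a - f^[n] a‖) :=
      (hca.tendsto.const_sub _).norm
    rw [sub_self, norm_zero] at this
    exact this.eventually_lt_const hε
  obtain ⟨r, hr, hball⟩ := Metric.eventually_nhds_iff.1 hcont
  refine ⟨r / (1 + B ^ 2), by positivity, fun b hb hab n => ?_⟩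
  rcases le_or_gt N n with hn | hn
  · refine (hN n hn a ha b hb).trans_le ?_
    have := min_le_left (ε / 3) 1
    linarith
  · refine (chordalDist_le_norm_sub _ _).trans_lt (hball ?_ n (Finset.mem_range.2 hn))
    rw [dist_comm, dist_eq_norm]
    refine (norm_sub_le_chordalDist_mul (hB a (subset_closure ha))
      (hB b (subset_closure hb))).trans_lt ?_
    rwa [lt_div_iff₀ (by positivity)] at hab

/-- For a map of nonzero index, a compact set of escaping points which carries no continuous
branch of `log (z ^ k)`, `k ≠ 0`, cannot escape uniformly. -/
theorem false_of_uniform_escape {f : ℂ → ℂ} {m : ℤ} {g h : ℂ → ℂ}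
    (hg : Differentiable ℂ g) (hh : Differentiable ℂ h)
    (hgnc : ¬ ∃ c : ℂ, ∀ z, g z = c) (hhnc : ¬ ∃ c : ℂ, ∀ z, h z = c)
    (hform : ∀ z : ℂ, z ≠ 0 → f z = z ^ m * Complex.exp (g z + h z⁻¹)) {C : Set ℂ}
    (hC : IsCompact C) (hlog : ∀ n : ℕ, ¬ HasContinuousLogOn f^[n] C)
    (hfd : ∀ n : ℕ, ContinuousOn f^[n] C) (hf0 : ∀ n : ℕ, ∀ w ∈ C, f^[n] w ≠ 0) (z : ℂ)
    (hunif : ∀ η : ℝ, 0 < η → η ≤ 1 → ∀ᶠ n : ℕ in atTop, ∀ w ∈ C,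
      (‖f^[n] z‖ ≤ 1 → ‖f^[n] w‖ < η) ∧ (1 < ‖f^[n] z‖ → 1 / η < ‖f^[n] w‖)) : False := by
  set s : ℕ → Prop := fun n => 1 < ‖f^[n] z‖ with hs
  have hη : ∀ R : ℝ, 0 < 1 / (|R| + 1) ∧ 1 / (|R| + 1) ≤ 1 := fun R =>
    ⟨by positivity, by
      rw [div_le_one (by positivity)]
      linarith [abs_nonneg R]⟩
  have hlarge : ∀ R : ℝ, ∀ᶠ n : ℕ in atTop, s n → ∀ w ∈ C, R < ‖f^[n] w‖ := fun R => by
    filter_upwards [hunif _ (hη R).1 (hη R).2] with n hn hsn w hw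
    have := (hn w hw).2 hsn
    rw [one_div_one_div] at this
    linarith [le_abs_self R]
  have hsmall : ∀ R : ℝ, ∀ᶠ n : ℕ in atTop, ¬ s n → ∀ w ∈ C, R < ‖(f^[n] w)⁻¹‖ := fun R => by
    filter_upwards [hunif _ (hη R).1 (hη R).2] with n hn hsn w hw
    have := (hn w hw).1 (not_lt.1 hsn)
    rw [one_div] at this
    rw [norm_inv]
    have := lt_inv_of_lt_inv₀ (norm_pos_iff.2 (hf0 n w hw)) this
    linarith [le_abs_self R]
  have hnext1 : ∀ᶠ n : ℕ in atTop, s (n + 1) → ∀ w ∈ C, 1 ≤ ‖f^[n + 1] w‖ :=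
    (tendsto_add_atTop_nat 1).eventually ((hlarge 1).mono fun n hn hsn w hw => (hn hsn w hw).le)
  have hnext0 : ∀ᶠ n : ℕ in atTop, ¬ s (n + 1) → ∀ w ∈ C, ‖f^[n + 1] w‖ ≤ 1 :=
    (tendsto_add_atTop_nat 1).eventually ((hunif 1 one_pos le_rfl).mono fun n hn hsn w hw =>
      ((hn w hw).1 (not_lt.1 hsn)).le)
  have hKc : ∀ n, IsCompact (f^[n] '' C) := fun n => hC.image_of_continuousOn (hfd n)
  have hKc' : ∀ n, IsCompact ((fun w => (f^[n] w)⁻¹) '' C) := fun n =>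
    hC.image_of_continuousOn ((hfd n).inv₀ (hf0 n))
  have hKl : ∀ n, ¬ HasContinuousLogOn id (f^[n] '' C) := fun n hcon =>
    hlog n (hcon.comp (hfd n))
  have hKl' : ∀ n, ¬ HasContinuousLogOn id ((fun w => (f^[n] w)⁻¹) '' C) := fun n hcon =>
    hlog n ((hcon.comp ((hfd n).inv₀ (hf0 n))).inv.congr fun w _ => (inv_inv _).symm)
  have hval : ∀ n, ∀ w ∈ C,
      (f^[n] w) ^ m * Complex.exp (g (f^[n] w) + h (f^[n] w)⁻¹) = f^[n + 1] w := fun n w hw => by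
    rw [Function.iterate_succ_apply', hform _ (hf0 n w hw)]
  have hval' : ∀ n, ∀ w ∈ C, ((f^[n] w)⁻¹) ^ (-m) *
      Complex.exp (h (f^[n] w)⁻¹ + g ((f^[n] w)⁻¹)⁻¹) = f^[n + 1] w := fun n w hw => by
    rw [inv_zpow', neg_neg, inv_inv, add_comm, hval n w hw]
  have hcases : ∃ᶠ n : ℕ in atTop,
      ((s n ∧ s (n + 1)) ∨ (s n ∧ ¬ s (n + 1))) ∨
        ((¬ s n ∧ s (n + 1)) ∨ (¬ s n ∧ ¬ s (n + 1))) :=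
    Eventually.frequently (Eventually.of_forall fun n => by tauto)
  rw [frequently_or_distrib, frequently_or_distrib, frequently_or_distrib] at hcases
  rcases hcases with (hfr | hfr) | (hfr | hfr)
  · refine hgnc (exists_eq_const_of_one_le_norm_on_separating hg hh (m := m) fun R => ?_)
    obtain ⟨n, ⟨h1, h2⟩, h3, h4⟩ := (hfr.and_eventually ((hlarge R).and hnext1)).exists
    refine ⟨_, hKc n, forall_mem_image.2 (h3 h1), hKl n, forall_mem_image.2 fun w hw => ?_⟩
    rw [hval n w hw]
    exact h4 h2 w hw
  · refine hgnc (exists_eq_const_of_norm_le_one_on_separating hg hh (m := m) fun R => ?_)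
    obtain ⟨n, ⟨h1, h2⟩, h3, h4⟩ := (hfr.and_eventually ((hlarge R).and hnext0)).exists
    refine ⟨_, hKc n, forall_mem_image.2 (h3 h1), hKl n, forall_mem_image.2 fun w hw => ?_⟩
    rw [hval n w hw]
    exact h4 h2 w hw
  · refine hhnc (exists_eq_const_of_one_le_norm_on_separating hh hg (m := -m) fun R => ?_)
    obtain ⟨n, ⟨h1, h2⟩, h3, h4⟩ := (hfr.and_eventually ((hsmall R).and hnext1)).exists
    refine ⟨_, hKc' n, forall_mem_image.2 (h3 h1), hKl' n, forall_mem_image.2 fun w hw => ?_⟩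
    rw [hval' n w hw]
    exact h4 h2 w hw
  · refine hhnc (exists_eq_const_of_norm_le_one_on_separating hh hg (m := -m) fun R => ?_)
    obtain ⟨n, ⟨h1, h2⟩, h3, h4⟩ := (hfr.and_eventually ((hsmall R).and hnext0)).exists
    refine ⟨_, hKc' n, forall_mem_image.2 (h3 h1), hKl' n, forall_mem_image.2 fun w hw => ?_⟩
    rw [hval' n w hw]
    exact h4 h2 w hw

/-- If a transcendental self-map `f(z) = z^m · exp(g(z) + h(1/z))` of `ℂ*`
has a doubly connected Baker domain, then `ind(f) = 0`, i.e. `m = 0`. -/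
theorem doubly_connected_baker_domain_index_zero (f : ℂ → ℂ) (m : ℤ) (g h : ℂ → ℂ)
    (hg : Differentiable ℂ g) (hh : Differentiable ℂ h)
    (hgnc : ¬ ∃ c : ℂ, ∀ z, g z = c) (hhnc : ¬ ∃ c : ℂ, ∀ z, h z = c)
    (hform : ∀ z : ℂ, z ≠ 0 → f z = z ^ m * Complex.exp (g z + h z⁻¹))
    (U : Set ℂ) (hU : IsFatouComponent f U) (p : ℕ) (hp : 0 < p)
    (hper : f^[p] '' U ⊆ U) (hUI : U ⊆ escapingSet f) (hdc : DoublyConnected U) :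
    m = 0 := by
  choose H hHd hH using exists_iterate_eq_zpow_mul_exp hg hh hform
  have hf0 : ∀ z ≠ 0, ∀ n : ℕ, f^[n] z ≠ 0 := fun z hz n => by
    rw [hH n z hz]
    exact mul_ne_zero (zpow_ne_zero _ hz) (Complex.exp_ne_zero _)
  have hfd : ∀ n : ℕ, DifferentiableOn ℂ f^[n] {0}ᶜ := fun n =>
    DifferentiableOn.congr (fun z hz => ((differentiableAt_zpow.2
      (Or.inl hz)).differentiableWithinAt.mul (hHd n z hz).cexp)) (hH n)
  have hUo : IsOpen U := hU.isOpen
  obtain ⟨z₀, hz₀F, hUcomp⟩ := hU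
  have hUF : U ⊆ FatouSet f := hUcomp ▸ connectedComponentIn_subset _ _
  have hUc : IsPreconnected U := hUcomp ▸ isPreconnected_connectedComponentIn
  have hz₀ : z₀ ∈ U := hUcomp ▸ mem_connectedComponentIn hz₀F
  have hU0 : U ⊆ {0}ᶜ := fun z hz => (hUF hz).1
  obtain ⟨A, hAc, hAne, hAU, hAUo⟩ := exists_compact_compl_component hUo hdc
  obtain ⟨W, hWo, hAW, hWAU, hWc⟩ :=
    exists_open_between_and_isCompact_closure hAc hAUo subset_union_left
  have hWU : frontier W ⊆ U := by
    rw [hWo.frontier_eq]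
    rintro w ⟨hw, hwW⟩
    exact (hWAU hw).resolve_left fun hwA => hwW (hAW hwA)
  have hCc : IsCompact (frontier W) :=
    hWc.of_isClosed_subset isClosed_frontier frontier_subset_closure
  by_cases h0 : (0 : ℂ) ∈ A
  · by_contra hm
    refine false_of_uniform_escape hg hh hgnc hhnc hform hCc (fun n hcon => ?_)
      (fun n => (hfd n).continuousOn.mono (hWU.trans hU0)) (fun n w hw => hf0 w (hU0 (hWU hw)) n)
      z₀ (fun η hη hη1 => eventually_iterate_uniform hf0 hUc hUF hUI hz₀ hCc hWU hη hη1)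
    refine not_hasContinuousLogOn_zpow_frontier hWo (hWc.isBounded.subset subset_closure)
      (hAW h0) (pow_ne_zero n hm) ((hcon.mul (v := fun z => Complex.exp (-H n z))
        ⟨_, ((hHd n).neg.continuousOn.mono (hWU.trans hU0)), fun _ _ => rfl⟩).congr
          fun z hz => ?_)
    rw [hH n z (hU0 (hWU hz)), mul_assoc, ← Complex.exp_add, add_neg_cancel, Complex.exp_zero,
      mul_one]
  · have hAU0 : A ∪ U ⊆ {0}ᶜ := union_subset (fun z hz h => h0 (h ▸ hz)) hU0
    have hWF := subset_fatouSet_of_frontier_subset hf0 hfd hUc hUF hUI hWo hWc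
      (hWAU.trans hAU0) hWU ⟨z₀, hz₀⟩
    obtain ⟨z, hzA, hzU⟩ : (A ∩ closure U).Nonempty := by
      by_contra hemp
      rw [not_nonempty_iff_eq_empty] at hemp
      have hAeq : A = (A ∪ U) ∩ (closure U)ᶜ := by
        ext w
        constructor
        · exact fun hw => ⟨Or.inl hw, fun hwU => hemp.subset ⟨hw, hwU⟩⟩
        · exact fun hw => hw.1.resolve_right fun hwU => hw.2 (subset_closure hwU)
      have hAo : IsOpen A := hAeq ▸ hAUo.inter isClosed_closure.isOpen_compl
      have := IsClopen.eq_univ ⟨hAc.isClosed, hAo⟩ hAne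
      exact noncompact_univ ℂ (this ▸ hAc)
    have hzF : z ∈ FatouSet f := hWF (hAW hzA)
    obtain ⟨y, hy, hyU⟩ := mem_closure_iff_nhds.1 hzU _
      ((isOpen_fatouSet f).connectedComponentIn.mem_nhds (mem_connectedComponentIn hzF))
    have h1 := connectedComponentIn_eq hy
    have h2 := connectedComponentIn_eq (hUcomp ▸ hyU : y ∈ connectedComponentIn (FatouSet f) z₀)
    refine absurd ?_ (Set.disjoint_left.1 hAU hzA)
    rw [hUcomp, h2, ← h1]
    exact mem_connectedComponentIn hzF
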